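/- For any irreducible finite set 𝒜 of real m×m matrices, any averaging function γ, any initial norm ‖·‖_0 on ℝ^m and any vector e with ‖e‖_0 = 1, the sequence of normalized norms ‖·‖°_n produced by the max-relaxation iteration converges, uniformly on every bounded subset of ℝ^m, to some Barabanov norm ‖·‖* of 𝒜. -/

import Mathlib

open Matrix Filter Topology Bornology Pointwise

/-- `N` is a norm on `ℝ^m`: nonnegative, definite, absolutely homogeneous, subadditive. -/
def IsNorm {m : ℕ} (N : (Fin m → ℝ) → ℝ) : Prop :=
  (∀ x, 0 ≤ N x) ∧ (∀ x, N x = 0 → x = 0) ∧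
    (∀ (t : ℝ) (x), N (t • x) = |t| * N x) ∧ (∀ x y, N (x + y) ≤ N x + N y)

/-- `N` is a seminorm on `ℝ^m`. -/
def IsSeminorm {m : ℕ} (N : (Fin m → ℝ) → ℝ) : Prop :=
  (∀ x, 0 ≤ N x) ∧
    (∀ (t : ℝ) (x), N (t • x) = |t| * N x) ∧ (∀ x y, N (x + y) ≤ N x + N y)

/-- The family `A` is irreducible: the matrices have no common invariant subspace
other than `⊥` and `⊤`. -/
def IsIrreducibleFamily {m r : ℕ} (A : Fin r → Matrix (Fin m) (Fin m) ℝ) : Prop :=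
  ∀ W : Submodule ℝ (Fin m → ℝ), (∀ i, ∀ x ∈ W, (A i).mulVec x ∈ W) → W = ⊥ ∨ W = ⊤

/-- The operator norm of a matrix acting on `ℝ^m` (with its sup norm). -/
noncomputable def matNorm {m : ℕ} (M : Matrix (Fin m) (Fin m) ℝ) : ℝ :=
  ‖LinearMap.toContinuousLinearMap M.mulVecLin‖

/-- The joint spectral radius of the family `A`:
`limsup_n (max over words of length n of the norm of the product)^(1/n)`. -/
noncomputable def jsr {m r : ℕ} (A : Fin r → Matrix (Fin m) (Fin m) ℝ) : ℝ :=
  Filter.atTop.limsup fun n : ℕ =>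
    (⨆ w : Fin n → Fin r, matNorm (List.ofFn fun k => A (w k)).prod) ^ (1 / (n : ℝ))

/-- `maxA A N x = max_i N (A_i x)`. -/
noncomputable def maxA {m r : ℕ} (A : Fin r → Matrix (Fin m) (Fin m) ℝ)
    (N : (Fin m → ℝ) → ℝ) (x : Fin m → ℝ) : ℝ :=
  ⨆ i, N ((A i).mulVec x)

/-- `ρ⁺ = max_{x ≠ 0} (max_i N (A_i x)) / N x`. -/
noncomputable def rhoSup {m r : ℕ} (A : Fin r → Matrix (Fin m) (Fin m) ℝ)
    (N : (Fin m → ℝ) → ℝ) : ℝ :=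
  sSup ((fun x => maxA A N x / N x) '' {x | x ≠ 0})

/-- `ρ⁻ = min_{x ≠ 0} (max_i N (A_i x)) / N x`. -/
noncomputable def rhoInf {m r : ℕ} (A : Fin r → Matrix (Fin m) (Fin m) ℝ)
    (N : (Fin m → ℝ) → ℝ) : ℝ :=
  sInf ((fun x => maxA A N x / N x) '' {x | x ≠ 0})

/-- An averaging function: continuous on positives, `γ t t = t`, and strictly
between `min` and `max` off the diagonal. -/
def IsAveraging (γ : ℝ → ℝ → ℝ) : Prop :=
  ContinuousOn (fun p : ℝ × ℝ => γ p.1 p.2) {p | 0 < p.1 ∧ 0 < p.2} ∧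
    (∀ t, 0 < t → γ t t = t) ∧
    ∀ t s, 0 < t → 0 < s → t ≠ s → min t s < γ t s ∧ γ t s < max t s

/-- The max-relaxation iteration: `‖x‖_{n+1} = max (‖x‖_n, γ_n⁻¹ max_i ‖A_i x‖_n)`
where `γ_n = γ (ρ⁻_n, ρ⁺_n)`. -/
noncomputable def iterN {m r : ℕ} (A : Fin r → Matrix (Fin m) (Fin m) ℝ)
    (γ : ℝ → ℝ → ℝ) (N0 : (Fin m → ℝ) → ℝ) : ℕ → (Fin m → ℝ) → ℝ
  | 0 => N0
  | n + 1 => fun x =>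
      max (iterN A γ N0 n x)
        ((γ (rhoInf A (iterN A γ N0 n)) (rhoSup A (iterN A γ N0 n)))⁻¹ *
          maxA A (iterN A γ N0 n) x)

/-- The normalized norms `‖x‖°_n = ‖x‖_n / ‖e‖_n` of the max-relaxation iteration
(for `n = 0` this equals `‖x‖_0` since `‖e‖_0 = 1`). -/
noncomputable def iterNnorm {m r : ℕ} (A : Fin r → Matrix (Fin m) (Fin m) ℝ)
    (γ : ℝ → ℝ → ℝ) (N0 : (Fin m → ℝ) → ℝ) (e : Fin m → ℝ) (n : ℕ) :
    (Fin m → ℝ) → ℝ :=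
  fun x => iterN A γ N0 n x / iterN A γ N0 n e

/-- `e⁺(N, N') = max_{x ≠ 0} N x / N' x`. -/
noncomputable def ePlus {m : ℕ} (N N' : (Fin m → ℝ) → ℝ) : ℝ :=
  sSup ((fun x => N x / N' x) '' {x | x ≠ 0})

/-- `e⁻(N, N') = min_{x ≠ 0} N x / N' x`. -/
noncomputable def eMinus {m : ℕ} (N N' : (Fin m → ℝ) → ℝ) : ℝ :=
  sInf ((fun x => N x / N' x) '' {x | x ≠ 0})

/-- The eccentricity of the norm `N` with respect to the norm `N'`. -/
noncomputable def ecc {m : ℕ} (N N' : (Fin m → ℝ) → ℝ) : ℝ :=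
  ePlus N N' / eMinus N N'

lemma IsNorm.isSeminorm {m : ℕ} {N : (Fin m → ℝ) → ℝ} (h : IsNorm N) : IsSeminorm N :=
  ⟨h.1, h.2.2.1, h.2.2.2⟩

lemma IsNorm.pos {m : ℕ} {N : (Fin m → ℝ) → ℝ} (h : IsNorm N) {x : Fin m → ℝ} (hx : x ≠ 0) :
    0 < N x :=
  lt_of_le_of_ne (h.1 x) fun h0 => hx (h.2.1 x h0.symm)

namespace IsSeminorm

variable {m : ℕ} {N : (Fin m → ℝ) → ℝ}

lemma map_zero (h : IsSeminorm N) : N 0 = 0 := by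
  simpa using h.2.1 0 0

lemma map_neg (h : IsSeminorm N) (x : Fin m → ℝ) : N (-x) = N x := by
  simpa using h.2.1 (-1) x

lemma abs_sub_le (h : IsSeminorm N) (x y : Fin m → ℝ) : |N x - N y| ≤ N (x - y) := by
  have h1 := h.2.2 (x - y) y
  have h2 := h.2.2 (y - x) x
  have h3 := h.map_neg (x - y)
  rw [neg_sub] at h3
  rw [sub_add_cancel] at h1 h2
  exact abs_le.2 ⟨by linarith, by linarith⟩

lemma sum_le (h : IsSeminorm N) {ι : Type*} (s : Finset ι) (f : ι → Fin m → ℝ) :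
    N (∑ i ∈ s, f i) ≤ ∑ i ∈ s, N (f i) :=
  Finset.le_sum_of_subadditive N h.map_zero.le h.2.2 s f

/-- A seminorm is bounded by the sum of its values on the standard basis. -/
lemma le_sum_mul_norm (h : IsSeminorm N) (x : Fin m → ℝ) :
    N x ≤ (∑ i, N (Pi.single i 1)) * ‖x‖ := by
  have hx : x = ∑ i, x i • (Pi.single i 1 : Fin m → ℝ) := by
    simpa [← Pi.single_smul] using (Finset.univ_sum_single x).symm
  calc N x = N (∑ i, x i • (Pi.single i 1 : Fin m → ℝ)) := by rw [← hx]
    _ ≤ ∑ i, N (x i • (Pi.single i 1 : Fin m → ℝ)) := h.sum_le _ _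
    _ ≤ ∑ i, N (Pi.single i 1) * ‖x‖ := by
        refine Finset.sum_le_sum fun i _ => ?_
        rw [h.2.1, mul_comm]
        exact mul_le_mul_of_nonneg_left (norm_le_pi_norm x i) (h.1 _)
    _ = _ := (Finset.sum_mul _ _ _).symm

lemma basisSum_nonneg (h : IsSeminorm N) : 0 ≤ ∑ i, N (Pi.single i 1) :=
  Finset.sum_nonneg fun _ _ => h.1 _

lemma continuous (h : IsSeminorm N) : Continuous N := by
  refine continuous_iff_continuousAt.2 fun x => tendsto_iff_dist_tendsto_zero.2 ?_
  have hlim : Tendsto (fun y => (∑ i, N (Pi.single i 1)) * ‖y - x‖) (𝓝 x) (𝓝 0) := by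
    have : Continuous fun y : Fin m → ℝ => (∑ i, N (Pi.single i 1)) * ‖y - x‖ := by fun_prop
    simpa using this.tendsto x
  exact squeeze_zero (fun _ => dist_nonneg)
    (fun y => (h.abs_sub_le y x).trans (h.le_sum_mul_norm _)) hlim

lemma const_mul (h : IsSeminorm N) {c : ℝ} (hc : 0 ≤ c) : IsSeminorm fun x => c * N x := by
  refine ⟨fun x => mul_nonneg hc (h.1 x), fun t x => ?_, fun x y => ?_⟩
  · simp only [h.2.1]; ring
  · rw [← mul_add]; exact mul_le_mul_of_nonneg_left (h.2.2 x y) hc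

/-- The pointwise limit of seminorms is a seminorm. -/
lemma of_tendsto {ι : Type*} {F : Filter ι} [F.NeBot] {p : ι → (Fin m → ℝ) → ℝ}
    (hp : ∀ k, IsSeminorm (p k)) (hlim : ∀ x, Tendsto (fun k => p k x) F (𝓝 (N x))) :
    IsSeminorm N := by
  refine ⟨fun x => ge_of_tendsto' (hlim x) fun k => (hp k).1 x, fun t x => ?_, fun x y => ?_⟩
  · refine tendsto_nhds_unique (hlim (t • x)) ?_
    simpa only [(hp _).2.1] using (hlim x).const_mul |t|
  · exact le_of_tendsto_of_tendsto' (hlim _) ((hlim x).add (hlim y)) fun k => (hp k).2.2 x y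

end IsSeminorm

/-- A norm on `ℝ^m` dominates a positive multiple of the sup norm. -/
lemma IsNorm.exists_lower_bound {m : ℕ} {N : (Fin m → ℝ) → ℝ} (h : IsNorm N) :
    ∃ c > 0, ∀ x, c * ‖x‖ ≤ N x := by
  by_cases hne : (Metric.sphere (0 : Fin m → ℝ) 1).Nonempty
  · obtain ⟨z, hz, hmin⟩ := (isCompact_sphere (0 : Fin m → ℝ) 1).exists_isMinOn hne
      h.isSeminorm.continuous.continuousOn
    have hz0 : z ≠ 0 := by rintro rfl; simp at hz
    refine ⟨N z, h.pos hz0, fun x => ?_⟩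
    rcases eq_or_ne x 0 with rfl | hx
    · simp [h.isSeminorm.map_zero]
    have hxn : 0 < ‖x‖ := norm_pos_iff.2 hx
    have hmem : ‖x‖⁻¹ • x ∈ Metric.sphere (0 : Fin m → ℝ) 1 := by
      simp [norm_smul, hxn.ne']
    have := hmin hmem
    rw [Set.mem_ofPred_eq, h.2.2.1, abs_of_pos (inv_pos.2 hxn)] at this
    rwa [le_inv_mul_iff₀ hxn, mul_comm] at this
  · refine ⟨1, one_pos, fun x => ?_⟩
    rcases eq_or_ne x 0 with rfl | hx
    · simp [h.isSeminorm.map_zero]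
    exact absurd ⟨‖x‖⁻¹ • x, by simp [norm_smul, norm_ne_zero_iff.2 hx]⟩ hne

/-- Uniformly bounded seminorms converge pointwise along an ultrafilter. -/
lemma exists_seminorm_ultrafilter_limit {m : ℕ} {ι : Type*} (U : Ultrafilter ι)
    {p : ι → (Fin m → ℝ) → ℝ} (hp : ∀ k, IsSeminorm (p k)) {B : ℝ}
    (hB : ∀ k x, p k x ≤ B * ‖x‖) :
    ∃ N, IsSeminorm N ∧ ∀ x, Tendsto (fun k => p k x) U (𝓝 (N x)) := by
  have : ∀ x, ∃ y, Tendsto (fun k => p k x) U (𝓝 y) := fun x => by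
    obtain ⟨y, -, hy⟩ := (isCompact_Icc (a := (0 : ℝ)) (b := B * ‖x‖)).ultrafilter_le_nhds'
      (U.map fun k => p k x)
      (Filter.mem_map.2 (Filter.univ_mem' fun k => ⟨(hp k).1 x, hB k x⟩))
    exact ⟨y, hy⟩
  choose N hN using this
  exact ⟨N, IsSeminorm.of_tendsto hp hN, hN⟩

lemma tendsto_seminorm_moving_point {m : ℕ} {ι : Type*} {F : Filter ι}
    {p : ι → (Fin m → ℝ) → ℝ} (hp : ∀ k, IsSeminorm (p k)) {B : ℝ}
    (hB : ∀ k x, p k x ≤ B * ‖x‖) {x : Fin m → ℝ} {a : ℝ}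
    (hx : Tendsto (fun k => p k x) F (𝓝 a)) {u : ι → Fin m → ℝ} (hu : Tendsto u F (𝓝 x)) :
    Tendsto (fun k => p k (u k)) F (𝓝 a) := by
  refine tendsto_of_tendsto_of_dist hx ?_
  have hlim : Tendsto (fun k => B * ‖x - u k‖) F (𝓝 0) := by
    simpa using ((tendsto_const_nhds (x := x)).sub hu).norm.const_mul B
  exact squeeze_zero (fun _ => dist_nonneg)
    (fun k => ((hp k).abs_sub_le _ _).trans (hB k _)) hlim

/-- Pointwise convergence of uniformly bounded seminorms to a norm is uniform relative to
that norm. -/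
lemma eventually_abs_sub_le_mul {m : ℕ} {ι : Type*} {F : Filter ι}
    {p : ι → (Fin m → ℝ) → ℝ} (hp : ∀ k, IsSeminorm (p k)) {B : ℝ}
    (hB : ∀ k x, p k x ≤ B * ‖x‖) {N : (Fin m → ℝ) → ℝ} (hN : IsNorm N)
    (hlim : ∀ x, Tendsto (fun k => p k x) F (𝓝 (N x))) {ε : ℝ} (hε : 0 < ε) :
    ∀ᶠ k in F, ∀ x, |p k x - N x| ≤ ε * N x := by
  refine Filter.mem_iff_ultrafilter.2 fun U hU => ?_
  by_contra hcon
  have hex : ∀ᶠ k in U, ∃ x ∈ Metric.sphere (0 : Fin m → ℝ) 1, ε * N x ≤ |p k x - N x| := by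
    refine Filter.mem_of_superset (Ultrafilter.compl_mem_iff_notMem.2 hcon) fun k hk => ?_
    simp only [Set.mem_compl_iff, Set.mem_ofPred_eq, not_forall, not_le] at hk
    obtain ⟨x, hx⟩ := hk
    have hx0 : x ≠ 0 := by
      rintro rfl
      simp [(hp k).map_zero, hN.isSeminorm.map_zero] at hx
    have hxn : 0 < ‖x‖ := norm_pos_iff.2 hx0
    refine ⟨‖x‖⁻¹ • x, by simp [norm_smul, hxn.ne'], ?_⟩
    rw [(hp k).2.1, hN.2.2.1, ← mul_sub, abs_mul, abs_abs, abs_of_pos (inv_pos.2 hxn),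
      mul_left_comm]
    exact mul_le_mul_of_nonneg_left hx.le (inv_pos.2 hxn).le
  choose! u hu using fun (k : ι)
    (hk : ∃ x ∈ Metric.sphere (0 : Fin m → ℝ) 1, ε * N x ≤ |p k x - N x|) => hk
  obtain ⟨z, hz, hzlim⟩ := (isCompact_sphere (0 : Fin m → ℝ) 1).ultrafilter_le_nhds'
    (U.map u) (Filter.mem_map.2 (hex.mono fun k hk => (hu k hk).1))
  have hz0 : z ≠ 0 := by rintro rfl; simp at hz
  have hzlim : Tendsto u U (𝓝 z) := hzlim
  have h1 := tendsto_seminorm_moving_point hp hB ((hlim z).mono_left hU) hzlim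
  have h2 := (hN.isSeminorm.continuous.tendsto z).comp hzlim
  have h3 := le_of_tendsto_of_tendsto (h2.const_mul ε) (h1.sub h2).abs
    (hex.mono fun k hk => (hu k hk).2)
  rw [sub_self, abs_zero] at h3
  exact absurd h3 (not_le.2 (mul_pos hε (hN.pos hz0)))

/-- For an irreducible family, all seminorms that the family expands by a factor at most `L`
are uniformly equivalent to the sup norm, up to scaling. -/
lemma IsIrreducibleFamily.exists_uniform_lower_bound {m r : ℕ}
    {A : Fin r → Matrix (Fin m) (Fin m) ℝ} (hA : IsIrreducibleFamily A) (L : ℝ) :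
    ∃ C > 0, ∀ N, IsSeminorm N → (∀ i x, N ((A i).mulVec x) ≤ L * N x) →
      ∀ x, (∑ j, N (Pi.single j 1)) * ‖x‖ ≤ C * N x := by
  by_contra! hcon
  choose N hN hL x hx using fun k : ℕ => hcon (k + 1) (by positivity)
  set s : ℕ → ℝ := fun k => ∑ j, N k (Pi.single j 1)
  have hs0 : ∀ k, 0 ≤ s k := fun k => (hN k).basisSum_nonneg
  have hprod : ∀ k, 0 < s k * ‖x k‖ := fun k =>
    (mul_nonneg (by positivity) ((hN k).1 _)).trans_lt (hx k)
  have hspos : ∀ k, 0 < s k := fun k => pos_of_mul_pos_left (hprod k) (norm_nonneg _)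
  have hxpos : ∀ k, 0 < ‖x k‖ := fun k => pos_of_mul_pos_right (hprod k) (hs0 k)
  set p : ℕ → (Fin m → ℝ) → ℝ := fun k y => (s k)⁻¹ * N k y with hpdef
  have hp : ∀ k, IsSeminorm (p k) := fun k => (hN k).const_mul (inv_pos.2 (hspos k)).le
  have hB : ∀ k y, p k y ≤ 1 * ‖y‖ := fun k y => by
    rw [one_mul, inv_mul_le_iff₀ (hspos k)]
    exact (hN k).le_sum_mul_norm y
  let U : Ultrafilter ℕ := Ultrafilter.of atTop
  have hU : (U : Filter ℕ) ≤ atTop := Ultrafilter.of_le atTop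
  obtain ⟨P, hP, hlim⟩ := exists_seminorm_ultrafilter_limit U hp hB
  have hPsum : ∑ j, P (Pi.single j 1) = 1 := by
    refine tendsto_nhds_unique (tendsto_finsetSum _ fun j _ => hlim (Pi.single j 1)) ?_
    refine (tendsto_congr fun k => ?_).2 tendsto_const_nhds
    rw [← Finset.mul_sum]
    exact inv_mul_cancel₀ (hspos k).ne'
  obtain ⟨z, hz, hzlim⟩ := (isCompact_sphere (0 : Fin m → ℝ) 1).ultrafilter_le_nhds'
    (U.map fun k => ‖x k‖⁻¹ • x k)
    (Filter.mem_map.2 (Filter.univ_mem' fun k => by simp [norm_smul, (hxpos k).ne']))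
  have hz0 : z ≠ 0 := by rintro rfl; simp at hz
  have hPz : P z = 0 := by
    have h1 := tendsto_seminorm_moving_point hp hB (hlim z) hzlim
    refine tendsto_nhds_unique h1 (squeeze_zero (fun k => (hp k).1 _) (fun k => ?_)
      (tendsto_one_div_add_atTop_nhds_zero_nat.mono_left hU))
    simp only [hpdef]
    rw [(hN k).2.1, abs_of_pos (inv_pos.2 (hxpos k)), inv_mul_le_iff₀ (hspos k),
      inv_mul_le_iff₀ (hxpos k), mul_one_div, mul_div_assoc', le_div_iff₀ (by positivity)]
    linarith [hx k]
  have hPA : ∀ i y, P ((A i).mulVec y) ≤ L * P y := fun i y =>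
    le_of_tendsto_of_tendsto' (hlim _) ((hlim y).const_mul L) fun k => by
      simp only [hpdef]
      rw [mul_left_comm]
      exact mul_le_mul_of_nonneg_left (hL k i y) (inv_pos.2 (hspos k)).le
  let W : Submodule ℝ (Fin m → ℝ) :=
    { carrier := {y | P y = 0}
      add_mem' := fun {a b} ha hb => le_antisymm
        ((hP.2.2 a b).trans_eq (by rw [show P a = 0 from ha, show P b = 0 from hb, add_zero]))
        (hP.1 _)
      zero_mem' := hP.map_zero
      smul_mem' := fun c y hy => by
        rw [Set.mem_ofPred_eq, hP.2.1, show P y = 0 from hy, mul_zero] }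
  rcases hA W fun i y (hy : P y = 0) => le_antisymm
    ((hPA i y).trans_eq (by rw [hy, mul_zero])) (hP.1 _) with hW | hW
  · exact hz0 ((Submodule.mem_bot ℝ).1 (hW ▸ (show z ∈ W from hPz)))
  · have hall : ∀ y, P y = 0 := fun y => show y ∈ W from hW ▸ Submodule.mem_top
    simp [hall] at hPsum

section maxA

variable {m r : ℕ} {A : Fin r → Matrix (Fin m) (Fin m) ℝ} {N : (Fin m → ℝ) → ℝ}

lemma le_maxA (A : Fin r → Matrix (Fin m) (Fin m) ℝ) (N : (Fin m → ℝ) → ℝ) (i : Fin r)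
    (x : Fin m → ℝ) : N ((A i).mulVec x) ≤ maxA A N x :=
  le_ciSup (f := fun i => N ((A i).mulVec x)) (Set.finite_range _).bddAbove i

lemma maxA_le (hr : 1 ≤ r) {x : Fin m → ℝ} {b : ℝ} (h : ∀ i, N ((A i).mulVec x) ≤ b) :
    maxA A N x ≤ b :=
  have : Nonempty (Fin r) := ⟨⟨0, hr⟩⟩
  ciSup_le h

lemma exists_eq_maxA (hr : 1 ≤ r) (A : Fin r → Matrix (Fin m) (Fin m) ℝ)
    (N : (Fin m → ℝ) → ℝ) (x : Fin m → ℝ) : ∃ i, N ((A i).mulVec x) = maxA A N x :=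
  have : Nonempty (Fin r) := ⟨⟨0, hr⟩⟩
  exists_eq_ciSup_of_finite

lemma IsSeminorm.maxA (hr : 1 ≤ r) (A : Fin r → Matrix (Fin m) (Fin m) ℝ) (h : IsSeminorm N) :
    IsSeminorm (maxA A N) := by
  refine ⟨fun x => (h.1 _).trans (le_maxA A N ⟨0, hr⟩ x), fun t x => ?_, fun x y => ?_⟩
  · simp only [_root_.maxA, mulVec_smul, h.2.1]
    exact (Real.mul_iSup_of_nonneg (abs_nonneg t) _).symm
  · refine maxA_le hr fun i => ?_
    rw [mulVec_add]
    exact (h.2.2 _ _).trans (add_le_add (le_maxA A N i x) (le_maxA A N i y))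

/-- An irreducible family in dimension at least two has no common kernel vector, so `maxA`
of a norm is again a norm. -/
lemma IsNorm.maxA (hm : 2 ≤ m) (hr : 1 ≤ r) (hA : IsIrreducibleFamily A) (h : IsNorm N) :
    IsNorm (maxA A N) := by
  obtain ⟨h1, h2, h3⟩ := h.isSeminorm.maxA hr A
  refine ⟨h1, fun x hx => ?_, h2, h3⟩
  have hker : ∀ i, (A i).mulVec x = 0 := fun i =>
    h.2.1 _ (le_antisymm ((le_maxA A N i x).trans_eq hx) (h.1 _))
  rcases hA (ℝ ∙ x) fun i y hy => by
    obtain ⟨c, rfl⟩ := Submodule.mem_span_singleton.1 hy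
    simp [mulVec_smul, hker] with hW | hW
  · exact Submodule.span_singleton_eq_bot.1 hW
  · have hle := finrank_span_le_card (R := ℝ) ({x} : Set (Fin m → ℝ))
    rw [hW, finrank_top] at hle
    simp at hle
    omega

lemma bddAbove_ratio (hr : 1 ≤ r) (A : Fin r → Matrix (Fin m) (Fin m) ℝ) (h : IsNorm N) :
    BddAbove ((fun x => maxA A N x / N x) '' {x | x ≠ 0}) := by
  obtain ⟨c, hc, hcN⟩ := h.exists_lower_bound
  have hM := h.isSeminorm.maxA hr A
  refine ⟨(∑ i, maxA A N (Pi.single i 1)) / c, ?_⟩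
  rintro _ ⟨x, hx, rfl⟩
  rw [div_le_div_iff₀ (h.pos hx) hc]
  calc maxA A N x * c ≤ (∑ i, maxA A N (Pi.single i 1)) * ‖x‖ * c :=
        mul_le_mul_of_nonneg_right (hM.le_sum_mul_norm x) hc.le
    _ = (∑ i, maxA A N (Pi.single i 1)) * (c * ‖x‖) := by ring
    _ ≤ _ := mul_le_mul_of_nonneg_left (hcN x) hM.basisSum_nonneg

lemma bddBelow_ratio (hr : 1 ≤ r) (A : Fin r → Matrix (Fin m) (Fin m) ℝ) (h : IsNorm N) :
    BddBelow ((fun x => maxA A N x / N x) '' {x | x ≠ 0}) := by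
  refine ⟨0, ?_⟩
  rintro _ ⟨x, -, rfl⟩
  exact div_nonneg ((h.isSeminorm.maxA hr A).1 x) (h.1 x)

lemma nonempty_ratio (hm : 2 ≤ m) (A : Fin r → Matrix (Fin m) (Fin m) ℝ)
    (N : (Fin m → ℝ) → ℝ) : ((fun x => maxA A N x / N x) '' {x | x ≠ 0}).Nonempty := by
  have : Nonempty (Fin m) := ⟨⟨0, by omega⟩⟩
  obtain ⟨x, hx⟩ := exists_ne (0 : Fin m → ℝ)
  exact ⟨_, x, hx, rfl⟩

lemma maxA_le_rhoSup_mul (hr : 1 ≤ r) (A : Fin r → Matrix (Fin m) (Fin m) ℝ) (h : IsNorm N)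
    (x : Fin m → ℝ) : maxA A N x ≤ rhoSup A N * N x := by
  rcases eq_or_ne x 0 with rfl | hx
  · rw [(h.isSeminorm.maxA hr A).map_zero, h.isSeminorm.map_zero, mul_zero]
  rw [← div_le_iff₀ (h.pos hx)]
  exact le_csSup (bddAbove_ratio hr A h) ⟨x, hx, rfl⟩

lemma rhoInf_mul_le_maxA (hr : 1 ≤ r) (A : Fin r → Matrix (Fin m) (Fin m) ℝ) (h : IsNorm N)
    (x : Fin m → ℝ) : rhoInf A N * N x ≤ maxA A N x := by
  rcases eq_or_ne x 0 with rfl | hx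
  · rw [(h.isSeminorm.maxA hr A).map_zero, h.isSeminorm.map_zero, mul_zero]
  rw [← le_div_iff₀ (h.pos hx)]
  exact csInf_le (bddBelow_ratio hr A h) ⟨x, hx, rfl⟩

lemma rhoSup_le (hm : 2 ≤ m) (h : IsNorm N) {L : ℝ} (hL : ∀ x, maxA A N x ≤ L * N x) :
    rhoSup A N ≤ L := by
  refine csSup_le (nonempty_ratio hm A N) ?_
  rintro _ ⟨x, hx, rfl⟩
  exact (div_le_iff₀ (h.pos hx)).2 (hL x)

lemma le_rhoInf (hm : 2 ≤ m) (h : IsNorm N) {l : ℝ} (hl : ∀ x, l * N x ≤ maxA A N x) :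
    l ≤ rhoInf A N := by
  refine le_csInf (nonempty_ratio hm A N) ?_
  rintro _ ⟨x, hx, rfl⟩
  exact (le_div_iff₀ (h.pos hx)).2 (hl x)

lemma rhoInf_le_rhoSup (hm : 2 ≤ m) (hr : 1 ≤ r) (A : Fin r → Matrix (Fin m) (Fin m) ℝ)
    (h : IsNorm N) : rhoInf A N ≤ rhoSup A N :=
  csInf_le_csSup (nonempty_ratio hm A N) (bddBelow_ratio hr A h) (bddAbove_ratio hr A h)

lemma exists_maxA_lt_of_rhoInf_lt (hm : 2 ≤ m) (h : IsNorm N) {c : ℝ} (hc : rhoInf A N < c) :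
    ∃ x, x ≠ 0 ∧ maxA A N x < c * N x := by
  obtain ⟨_, ⟨x, hx, rfl⟩, hlt⟩ := exists_lt_of_csInf_lt (nonempty_ratio hm A N) hc
  exact ⟨x, hx, (div_lt_iff₀ (h.pos hx)).1 hlt⟩

lemma rhoInf_pos (hm : 2 ≤ m) (hr : 1 ≤ r) (hA : IsIrreducibleFamily A) (h : IsNorm N) :
    0 < rhoInf A N := by
  obtain ⟨c, hc, hcM⟩ := (h.maxA hm hr hA).exists_lower_bound
  set D := ∑ i, N (Pi.single i 1)
  have hD : 0 ≤ D := h.isSeminorm.basisSum_nonneg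
  refine (div_pos hc (by positivity : 0 < D + 1)).trans_le (le_rhoInf hm h fun x => ?_)
  rw [div_mul_eq_mul_div, div_le_iff₀ (by positivity)]
  have h1 := h.isSeminorm.le_sum_mul_norm x
  have h2 := hcM x
  calc c * N x ≤ c * (D * ‖x‖) := mul_le_mul_of_nonneg_left h1 hc.le
    _ = c * ‖x‖ * D := by ring
    _ ≤ maxA A N x * D := mul_le_mul_of_nonneg_right h2 hD
    _ ≤ maxA A N x * (D + 1) :=
        mul_le_mul_of_nonneg_left (by linarith) ((h.isSeminorm.maxA hr A).1 x)

end maxA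

lemma IsAveraging.mem_Icc {γ : ℝ → ℝ → ℝ} (hγ : IsAveraging γ) {t s : ℝ} (ht : 0 < t)
    (hts : t ≤ s) : t ≤ γ t s ∧ γ t s ≤ s := by
  rcases hts.eq_or_lt with rfl | hlt
  · simp [hγ.2.1 t ht]
  · have := hγ.2.2 t s ht (ht.trans hlt) hlt.ne
    rw [min_eq_left hts, max_eq_right hts] at this
    exact ⟨this.1.le, this.2.le⟩

/-- One step of the max-relaxation scheme with relaxation parameter `g`. -/
noncomputable def relax {m r : ℕ} (A : Fin r → Matrix (Fin m) (Fin m) ℝ) (g : ℝ)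
    (N : (Fin m → ℝ) → ℝ) (x : Fin m → ℝ) : ℝ :=
  max (N x) (g⁻¹ * maxA A N x)

section relax

variable {m r : ℕ} {A : Fin r → Matrix (Fin m) (Fin m) ℝ} {N : (Fin m → ℝ) → ℝ} {g : ℝ}

lemma le_relax (x : Fin m → ℝ) : N x ≤ relax A g N x := le_max_left _ _

lemma maxA_le_mul_relax (hg : 0 < g) (x : Fin m → ℝ) : maxA A N x ≤ g * relax A g N x :=
  (inv_mul_le_iff₀ hg).1 (le_max_right _ _)

lemma maxA_mono (hr : 1 ≤ r) {N' : (Fin m → ℝ) → ℝ} (h : ∀ x, N x ≤ N' x) (x : Fin m → ℝ) :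
    maxA A N x ≤ maxA A N' x :=
  maxA_le hr fun i => (h _).trans (le_maxA A N' i x)

lemma IsNorm.relax (hr : 1 ≤ r) (h : IsNorm N) (hg : 0 < g) : IsNorm (relax A g N) := by
  have hM := h.isSeminorm.maxA hr A
  have hg' := (inv_pos.2 hg).le
  refine ⟨fun x => (h.1 x).trans (le_relax x), fun x hx => ?_, fun t x => ?_, fun x y => ?_⟩
  · exact h.2.1 x (le_antisymm ((le_relax x).trans_eq hx) (h.1 x))
  · rw [_root_.relax, _root_.relax, h.2.2.1, hM.2.1, mul_max_of_nonneg _ _ (abs_nonneg t),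
      mul_left_comm]
  · refine max_le ?_ ?_
    · exact (h.2.2.2 x y).trans (add_le_add (le_relax x) (le_relax y))
    · refine (mul_le_mul_of_nonneg_left (hM.2.2 x y) hg').trans ?_
      rw [mul_add]
      exact add_le_add (le_max_right _ _) (le_max_right _ _)

lemma maxA_relax_le (hr : 1 ≤ r) (hg : 0 < g) {L : ℝ} (hL : 0 ≤ L)
    (h : ∀ x, maxA A N x ≤ L * N x) (x : Fin m → ℝ) :
    maxA A (relax A g N) x ≤ L * relax A g N x := by
  refine maxA_le hr fun i => max_le ?_ ?_
  · exact ((le_maxA A N i x).trans (h x)).trans (mul_le_mul_of_nonneg_left (le_relax x) hL)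
  · calc g⁻¹ * maxA A N ((A i).mulVec x) ≤ g⁻¹ * (L * maxA A N x) :=
          mul_le_mul_of_nonneg_left
            ((h _).trans (mul_le_mul_of_nonneg_left (le_maxA A N i x) hL)) (inv_pos.2 hg).le
      _ = L * (g⁻¹ * maxA A N x) := by ring
      _ ≤ _ := mul_le_mul_of_nonneg_left (le_max_right _ _) hL

lemma le_maxA_relax (hr : 1 ≤ r) (hg : 0 < g) {l : ℝ} (hl : 0 ≤ l)
    (h : ∀ x, l * N x ≤ maxA A N x) (x : Fin m → ℝ) :
    l * relax A g N x ≤ maxA A (relax A g N) x := by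
  rw [relax, mul_max_of_nonneg _ _ hl]
  refine max_le ((h x).trans (maxA_mono hr le_relax x)) ?_
  obtain ⟨i, hi⟩ := exists_eq_maxA hr A N x
  rw [← hi, mul_left_comm]
  calc g⁻¹ * (l * N ((A i).mulVec x)) ≤ g⁻¹ * maxA A N ((A i).mulVec x) :=
        mul_le_mul_of_nonneg_left (h _) (inv_pos.2 hg).le
    _ ≤ relax A g N ((A i).mulVec x) := le_max_right _ _
    _ ≤ _ := le_maxA A _ i x

/-- A vector that is expanded by a factor less than the relaxation parameter after the step was
already so before the step, and its norm does not change. -/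
lemma relax_eq_of_maxA_relax_le (hm : 2 ≤ m) (hr : 1 ≤ r) (hA : IsIrreducibleFamily A)
    (h : IsNorm N) (hg : 0 < g) {c : ℝ} (hc : c < g) {x : Fin m → ℝ} (hx : x ≠ 0)
    (hle : maxA A (relax A g N) x ≤ c * relax A g N x) :
    relax A g N x = N x ∧ maxA A N x ≤ c * N x := by
  have hpos : 0 < maxA A N x := (h.maxA hm hr hA).pos hx
  have hmono : maxA A N x ≤ c * relax A g N x := (maxA_mono hr le_relax x).trans hle
  have heq : relax A g N x = N x := by
    rcases max_choice (N x) (g⁻¹ * maxA A N x) with h1 | h1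
    · exact h1
    · rw [relax, h1, ← mul_assoc, ← div_eq_mul_inv] at hmono
      have : c / g * maxA A N x < 1 * maxA A N x :=
        mul_lt_mul_of_pos_right ((div_lt_one hg).2 hc) hpos
      linarith
  exact ⟨heq, heq ▸ hmono⟩

/-- If the least expansion factors of the relaxed norms stay below a constant `c` that is less
than all relaxation parameters, then the relaxed norms stay bounded and the greatest expansion
factors are eventually below any bound exceeding the limit of the relaxation parameters. -/
lemma eventually_rhoSup_le_of_rhoInf_lt (hm : 2 ≤ m) (hr : 1 ≤ r) (hA : IsIrreducibleFamily A)
    {N : ℕ → (Fin m → ℝ) → ℝ} {g : ℕ → ℝ} (hN : ∀ n, IsNorm (N n)) (hg : ∀ n, 0 < g n)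
    (hstep : ∀ n, N (n + 1) = relax A (g n) (N n)) {L : ℝ}
    (hL : ∀ n x, maxA A (N n) x ≤ L * N n x) {c : ℝ} (hc : ∀ n, c < g n)
    (hinf : ∀ n, rhoInf A (N n) < c) {g' : ℝ} (hg' : 0 < g') (hlim : Tendsto g atTop (𝓝 g'))
    {b : ℝ} (hb : g' < b) : ∀ᶠ n in atTop, rhoSup A (N n) ≤ b := by
  have hback : ∀ n x, x ≠ 0 → maxA A (N n) x ≤ c * N n x → N n x = N 0 x := by
    intro n x hx
    induction n with
    | zero => exact fun _ => rfl
    | succ n ih =>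
      intro hle
      rw [hstep] at hle ⊢
      obtain ⟨h1, h2⟩ := relax_eq_of_maxA_relax_le hm hr hA (hN n) (hg n) (hc n) hx hle
      rw [h1, ih h2]
  obtain ⟨C, hC, hCN⟩ := hA.exists_uniform_lower_bound L
  have hB : ∀ n x, N n x ≤ C * (∑ j, N 0 (Pi.single j 1)) * ‖x‖ := by
    intro n x
    obtain ⟨z, hz, hzc⟩ := exists_maxA_lt_of_rhoInf_lt hm (hN n) (hinf n)
    have h1 := hCN (N n) (hN n).isSeminorm (fun i x => (le_maxA A _ i x).trans (hL n x)) z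
    rw [hback n z hz hzc.le] at h1
    have h2 := h1.trans (mul_le_mul_of_nonneg_left ((hN 0).isSeminorm.le_sum_mul_norm z) hC.le)
    rw [← mul_assoc] at h2
    exact ((hN n).isSeminorm.le_sum_mul_norm x).trans
      (mul_le_mul_of_nonneg_right (le_of_mul_le_mul_right h2 (norm_pos_iff.2 hz)) (norm_nonneg x))
  have hmono : ∀ x, Monotone fun n => N n x := fun x => monotone_nat_of_le_succ fun n => by
    simp only [hstep n]
    exact le_relax x
  have hbdd : ∀ x, BddAbove (Set.range fun n => N n x) := fun x =>
    ⟨_, Set.forall_mem_range.2 fun n => hB n x⟩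
  set P : (Fin m → ℝ) → ℝ := fun x => ⨆ n, N n x
  have hNP : ∀ n x, N n x ≤ P x := fun n x => le_ciSup (hbdd x) n
  have hPlim : ∀ x, Tendsto (fun n => N n x) atTop (𝓝 (P x)) := fun x =>
    tendsto_atTop_ciSup (hmono x) (hbdd x)
  have hPs : IsSeminorm P := IsSeminorm.of_tendsto (fun n => (hN n).isSeminorm) hPlim
  have hPn : IsNorm P := ⟨hPs.1, fun x hx =>
    (hN 0).2.1 x (le_antisymm ((hNP 0 x).trans_eq hx) ((hN 0).1 x)), hPs.2⟩
  have hPA : ∀ x, maxA A P x ≤ g' * P x := fun x => maxA_le hr fun i => by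
    refine le_of_tendsto_of_tendsto' (hPlim _) (hlim.mul ((tendsto_add_atTop_iff_nat 1).2 (hPlim x)))
      fun n => ?_
    rw [hstep]
    exact (le_maxA A (N n) i x).trans (maxA_le_mul_relax (hg n) x)
  have hb0 : 0 < b := hg'.trans hb
  filter_upwards [eventually_abs_sub_le_mul (fun n => (hN n).isSeminorm) hB hPn hPlim
    (div_pos (sub_pos.2 hb) hb0)] with n hn
  refine rhoSup_le hm (hN n) fun x => ?_
  have h1 := (abs_le.1 (hn x)).1
  have h2 : g' * P x = b * (P x - (b - g') / b * P x) := by field_simp; ring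
  calc maxA A (N n) x ≤ maxA A P x := maxA_mono hr (hNP n) x
    _ ≤ g' * P x := hPA x
    _ ≤ b * N n x := by
      rw [h2]
      exact mul_le_mul_of_nonneg_left (by linarith) hb0.le

end relax

section iterN

variable {m r : ℕ} {A : Fin r → Matrix (Fin m) (Fin m) ℝ} {γ : ℝ → ℝ → ℝ}
  {N0 : (Fin m → ℝ) → ℝ}

/-- The relaxation parameter `γ (ρ⁻, ρ⁺)` attached to a norm. -/
noncomputable def relaxParam {m r : ℕ} (A : Fin r → Matrix (Fin m) (Fin m) ℝ)
    (γ : ℝ → ℝ → ℝ) (N : (Fin m → ℝ) → ℝ) : ℝ :=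
  γ (rhoInf A N) (rhoSup A N)

lemma relaxParam_pos (hm : 2 ≤ m) (hr : 1 ≤ r) (hA : IsIrreducibleFamily A)
    (hγ : IsAveraging γ) {N : (Fin m → ℝ) → ℝ} (hN : IsNorm N) : 0 < relaxParam A γ N :=
  (rhoInf_pos hm hr hA hN).trans_le
    (hγ.mem_Icc (rhoInf_pos hm hr hA hN) (rhoInf_le_rhoSup hm hr A hN)).1

lemma iterN_succ (n : ℕ) :
    iterN A γ N0 (n + 1) = relax A (relaxParam A γ (iterN A γ N0 n)) (iterN A γ N0 n) :=
  rfl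

lemma IsNorm.iterN (hm : 2 ≤ m) (hr : 1 ≤ r) (hA : IsIrreducibleFamily A)
    (hγ : IsAveraging γ) (hN0 : IsNorm N0) (n : ℕ) : IsNorm (iterN A γ N0 n) := by
  induction n with
  | zero => exact hN0
  | succ n ih => exact ih.relax hr (relaxParam_pos hm hr hA hγ ih)

lemma monotone_rhoInf_iterN (hm : 2 ≤ m) (hr : 1 ≤ r) (hA : IsIrreducibleFamily A)
    (hγ : IsAveraging γ) (hN0 : IsNorm N0) : Monotone fun n => rhoInf A (iterN A γ N0 n) :=
  monotone_nat_of_le_succ fun n => by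
    have h := hN0.iterN hm hr hA hγ
    exact le_rhoInf hm (h (n + 1)) (le_maxA_relax hr (relaxParam_pos hm hr hA hγ (h n))
      (rhoInf_pos hm hr hA (h n)).le (rhoInf_mul_le_maxA hr A (h n)))

lemma antitone_rhoSup_iterN (hm : 2 ≤ m) (hr : 1 ≤ r) (hA : IsIrreducibleFamily A)
    (hγ : IsAveraging γ) (hN0 : IsNorm N0) : Antitone fun n => rhoSup A (iterN A γ N0 n) :=
  antitone_nat_of_succ_le fun n => by
    have h := hN0.iterN hm hr hA hγ
    exact rhoSup_le hm (h (n + 1)) (maxA_relax_le hr (relaxParam_pos hm hr hA hγ (h n))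
      ((rhoInf_pos hm hr hA (h n)).le.trans (rhoInf_le_rhoSup hm hr A (h n)))
      (maxA_le_rhoSup_mul hr A (h n)))

/-- The least and the greatest expansion factors converge to a common positive limit. -/
lemma exists_tendsto_rhoInf_rhoSup (hm : 2 ≤ m) (hr : 1 ≤ r) (hA : IsIrreducibleFamily A)
    (hγ : IsAveraging γ) (hN0 : IsNorm N0) :
    ∃ ρ > 0, Tendsto (fun n => rhoInf A (iterN A γ N0 n)) atTop (𝓝 ρ) ∧
      Tendsto (fun n => rhoSup A (iterN A γ N0 n)) atTop (𝓝 ρ) := by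
  have hN := hN0.iterN hm hr hA hγ
  have hmono := monotone_rhoInf_iterN hm hr hA hγ hN0
  have hanti := antitone_rhoSup_iterN hm hr hA hγ hN0
  have hle := fun n => rhoInf_le_rhoSup hm hr A (hN n)
  have hbdd : BddAbove (Set.range fun n => rhoInf A (iterN A γ N0 n)) :=
    ⟨_, Set.forall_mem_range.2 fun n => (hle n).trans (hanti (Nat.zero_le n))⟩
  have hbdd' : BddBelow (Set.range fun n => rhoSup A (iterN A γ N0 n)) :=
    ⟨_, Set.forall_mem_range.2 fun n => (hmono (Nat.zero_le n)).trans (hle n)⟩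
  have hlima := tendsto_atTop_ciSup hmono hbdd
  have hlimb := tendsto_atTop_ciInf hanti hbdd'
  set a := ⨆ n, rhoInf A (iterN A γ N0 n)
  set b := ⨅ n, rhoSup A (iterN A γ N0 n)
  have ha : ∀ n, rhoInf A (iterN A γ N0 n) ≤ a := fun n => le_ciSup hbdd n
  have hb : ∀ n, b ≤ rhoSup A (iterN A γ N0 n) := fun n => ciInf_le hbdd' n
  have ha0 : 0 < a := (rhoInf_pos hm hr hA (hN 0)).trans_le (ha 0)
  have hab : a ≤ b := le_of_tendsto_of_tendsto' hlima hlimb hle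
  suffices hba : a = b from ⟨a, ha0, hlima, hba ▸ hlimb⟩
  by_contra hne
  have hb0 : 0 < b := ha0.trans_le hab
  obtain ⟨hag, hgb⟩ := hγ.2.2 a b ha0 hb0 hne
  rw [min_eq_left hab] at hag
  rw [max_eq_right hab] at hgb
  have hlimg : Tendsto (fun n => relaxParam A γ (iterN A γ N0 n)) atTop (𝓝 (γ a b)) := by
    have hcont : ContinuousAt (fun p : ℝ × ℝ => γ p.1 p.2) (a, b) :=
      hγ.1.continuousAt (((isOpen_lt continuous_const continuous_fst).inter
        (isOpen_lt continuous_const continuous_snd)).mem_nhds ⟨ha0, hb0⟩)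
    exact hcont.tendsto.comp (hlima.prodMk_nhds hlimb)
  obtain ⟨c, hac, hcg⟩ := exists_between hag
  obtain ⟨b', hgb', hb'b⟩ := exists_between hgb
  obtain ⟨n₀, hn₀⟩ := eventually_atTop.1 (hlimg.eventually (lt_mem_nhds hcg))
  obtain ⟨n, hn⟩ := (eventually_rhoSup_le_of_rhoInf_lt hm hr hA
    (N := fun n => iterN A γ N0 (n + n₀)) (fun n => hN (n + n₀))
    (fun n => relaxParam_pos hm hr hA hγ (hN (n + n₀)))
    (fun n => by rw [add_right_comm, iterN_succ]) (L := rhoSup A N0)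
    (fun n x => (maxA_le_rhoSup_mul hr A (hN (n + n₀)) x).trans
      (mul_le_mul_of_nonneg_right (hanti (Nat.zero_le _)) ((hN _).1 x)))
    (fun n => hn₀ (n + n₀) (Nat.le_add_left _ _)) (fun n => (ha _).trans_lt hac)
    (ha0.trans hag) ((tendsto_add_atTop_iff_nat n₀).2 hlimg) hgb').exists
  exact absurd (hn.trans_lt hb'b) (not_lt.2 (hb _))

end iterN

section jsr

variable {m r : ℕ} {A : Fin r → Matrix (Fin m) (Fin m) ℝ} {N : (Fin m → ℝ) → ℝ} {ρ : ℝ}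

lemma seminorm_prod_mulVec_le (hρ : 0 ≤ ρ) (hle : ∀ x, maxA A N x ≤ ρ * N x) (n : ℕ)
    (w : Fin n → Fin r) (x : Fin m → ℝ) :
    N ((List.ofFn fun k => A (w k)).prod.mulVec x) ≤ ρ ^ n * N x := by
  induction n with
  | zero => simp
  | succ n ih =>
    rw [List.ofFn_succ, List.prod_cons, ← mulVec_mulVec, pow_succ', mul_assoc]
    exact ((le_maxA A N _ _).trans (hle _)).trans
      (mul_le_mul_of_nonneg_left (ih fun k => w k.succ) hρ)

lemma exists_le_seminorm_prod_mulVec (hr : 1 ≤ r) (hρ : 0 ≤ ρ)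
    (hle : ∀ x, ρ * N x ≤ maxA A N x) (n : ℕ) (x : Fin m → ℝ) :
    ∃ w : Fin n → Fin r, ρ ^ n * N x ≤ N ((List.ofFn fun k => A (w k)).prod.mulVec x) := by
  induction n with
  | zero => exact ⟨Fin.elim0, by simp⟩
  | succ n ih =>
    obtain ⟨w, hw⟩ := ih
    obtain ⟨i, hi⟩ := exists_eq_maxA hr A N ((List.ofFn fun k => A (w k)).prod.mulVec x)
    refine ⟨Fin.cons i w, ?_⟩
    simp only [List.ofFn_succ, List.prod_cons, ← mulVec_mulVec, Fin.cons_zero, Fin.cons_succ]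
    rw [hi, pow_succ', mul_assoc]
    exact (mul_le_mul_of_nonneg_left hw hρ).trans (hle _)

/-- The factor in the Barabanov identity is the joint spectral radius. -/
lemma jsr_eq_of_maxA_eq (hm : 2 ≤ m) (hr : 1 ≤ r) (hN : IsNorm N) (hρ : 0 ≤ ρ)
    (h : ∀ x, maxA A N x = ρ * N x) : jsr A = ρ := by
  have : Nonempty (Fin m) := ⟨⟨0, by omega⟩⟩
  have : Nonempty (Fin r) := ⟨⟨0, hr⟩⟩
  obtain ⟨c, hc, hcN⟩ := hN.exists_lower_bound
  set D := ∑ j, N (Pi.single j 1)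
  have hND : ∀ x, N x ≤ D * ‖x‖ := hN.isSeminorm.le_sum_mul_norm
  obtain ⟨z, hz⟩ := exists_ne (0 : Fin m → ℝ)
  have hzn : 0 < ‖z‖ := norm_pos_iff.2 hz
  have hD : 0 < D := pos_of_mul_pos_left ((hN.pos hz).trans_le (hND z)) hzn.le
  set S : ℕ → ℝ := fun n => ⨆ w : Fin n → Fin r, matNorm (List.ofFn fun k => A (w k)).prod
  have hupper : ∀ n, S n ≤ D / c * ρ ^ n := fun n => ciSup_le fun w => by
    refine ContinuousLinearMap.opNorm_le_bound _ (by positivity) fun x => ?_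
    rw [div_mul_eq_mul_div, div_mul_eq_mul_div, le_div_iff₀ hc, mul_comm]
    calc c * ‖(List.ofFn fun k => A (w k)).prod.mulVec x‖
        ≤ N ((List.ofFn fun k => A (w k)).prod.mulVec x) := hcN _
      _ ≤ ρ ^ n * N x := seminorm_prod_mulVec_le hρ (fun x => (h x).le) n w x
      _ ≤ ρ ^ n * (D * ‖x‖) := mul_le_mul_of_nonneg_left (hND x) (by positivity)
      _ = _ := by ring
  have hlower : ∀ n, c / D * ρ ^ n ≤ S n := fun n => by
    obtain ⟨w, hw⟩ := exists_le_seminorm_prod_mulVec hr hρ (fun x => (h x).ge) n z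
    refine le_trans ?_ (le_ciSup
      (f := fun w : Fin n → Fin r => matNorm (List.ofFn fun k => A (w k)).prod)
      (Set.finite_range _).bddAbove w)
    have hop : ‖(List.ofFn fun k => A (w k)).prod.mulVec z‖ ≤
        matNorm (List.ofFn fun k => A (w k)).prod * ‖z‖ :=
      ContinuousLinearMap.le_opNorm
        (LinearMap.toContinuousLinearMap (List.ofFn fun k => A (w k)).prod.mulVecLin) z
    refine le_of_mul_le_mul_right ?_ hzn
    refine le_trans ?_ hop
    rw [div_mul_eq_mul_div, div_mul_eq_mul_div, div_le_iff₀ hD, mul_comm _ D]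
    calc c * ρ ^ n * ‖z‖ = ρ ^ n * (c * ‖z‖) := by ring
      _ ≤ ρ ^ n * N z := mul_le_mul_of_nonneg_left (hcN z) (by positivity)
      _ ≤ _ := hw.trans (hND _)
  have hroot : ∀ K : ℝ, 0 < K →
      Tendsto (fun n : ℕ => (K * ρ ^ n) ^ (1 / (n : ℝ))) atTop (𝓝 ρ) := fun K hK => by
    have h1 : Tendsto (fun n : ℕ => K ^ (1 / (n : ℝ)) * ρ) atTop (𝓝 (K ^ (0 : ℝ) * ρ)) :=
      ((Real.continuousAt_const_rpow hK.ne').tendsto.comp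
        tendsto_one_div_atTop_nhds_zero_nat).mul_const ρ
    rw [Real.rpow_zero, one_mul] at h1
    refine h1.congr' ?_
    filter_upwards [eventually_ne_atTop 0] with n hn
    rw [Real.mul_rpow hK.le (by positivity), one_div, Real.pow_rpow_inv_natCast hρ hn]
  refine Tendsto.limsup_eq (tendsto_of_tendsto_of_tendsto_of_le_of_le
    (hroot (c / D) (div_pos hc hD)) (hroot (D / c) (div_pos hD hc)) (fun n => ?_) fun n => ?_)
  · exact Real.rpow_le_rpow (by positivity) (hlower n) (by positivity)
  · exact Real.rpow_le_rpow ((by positivity : 0 ≤ c / D * ρ ^ n).trans (hlower n)) (hupper n)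
      (by positivity)

end jsr

section limit

variable {m r : ℕ} {A : Fin r → Matrix (Fin m) (Fin m) ℝ} {γ : ℝ → ℝ → ℝ}
  {N0 : (Fin m → ℝ) → ℝ} {e : Fin m → ℝ}

lemma IsSeminorm.iterNnorm (hm : 2 ≤ m) (hr : 1 ≤ r) (hA : IsIrreducibleFamily A)
    (hγ : IsAveraging γ) (hN0 : IsNorm N0) (n : ℕ) : IsSeminorm (iterNnorm A γ N0 e n) := by
  have h := hN0.iterN hm hr hA hγ n
  have hs := h.isSeminorm.const_mul (inv_nonneg.2 (h.1 e))
  simp only [inv_mul_eq_div] at hs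
  exact hs

/-- The normalized norms are uniformly equivalent to the sup norm. -/
lemma exists_iterNnorm_bounds (hm : 2 ≤ m) (hr : 1 ≤ r) (hA : IsIrreducibleFamily A)
    (hγ : IsAveraging γ) (hN0 : IsNorm N0) (he : e ≠ 0) :
    ∃ c > 0, ∃ B, ∀ n x, c * ‖x‖ ≤ iterNnorm A γ N0 e n x ∧
      iterNnorm A γ N0 e n x ≤ B * ‖x‖ := by
  have hN := hN0.iterN hm hr hA hγ
  obtain ⟨C, hC, hCN⟩ := hA.exists_uniform_lower_bound (rhoSup A N0)
  have hen : 0 < ‖e‖ := norm_pos_iff.2 he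
  refine ⟨1 / (C * ‖e‖), by positivity, C / ‖e‖, fun n x => ?_⟩
  have hCn := hCN (iterN A γ N0 n) (hN n).isSeminorm fun i x =>
    (le_maxA A _ i x).trans ((maxA_le_rhoSup_mul hr A (hN n) x).trans
      (mul_le_mul_of_nonneg_right (antitone_rhoSup_iterN hm hr hA hγ hN0 (Nat.zero_le n))
        ((hN n).1 x)))
  have hx := (hN n).isSeminorm.le_sum_mul_norm x
  have hex := (hN n).isSeminorm.le_sum_mul_norm e
  have hepos := (hN n).pos he
  rw [iterNnorm]
  constructor
  · rw [div_mul_eq_mul_div, one_mul, div_le_div_iff₀ (by positivity) hepos]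
    calc ‖x‖ * iterN A γ N0 n e
        ≤ ‖x‖ * ((∑ j, iterN A γ N0 n (Pi.single j 1)) * ‖e‖) :=
          mul_le_mul_of_nonneg_left hex (norm_nonneg x)
      _ = (∑ j, iterN A γ N0 n (Pi.single j 1)) * ‖x‖ * ‖e‖ := by ring
      _ ≤ C * iterN A γ N0 n x * ‖e‖ := mul_le_mul_of_nonneg_right (hCn x) hen.le
      _ = _ := by ring
  · rw [div_mul_eq_mul_div, div_le_div_iff₀ hepos hen]
    calc iterN A γ N0 n x * ‖e‖
        ≤ (∑ j, iterN A γ N0 n (Pi.single j 1)) * ‖x‖ * ‖e‖ :=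
          mul_le_mul_of_nonneg_right hx hen.le
      _ = (∑ j, iterN A γ N0 n (Pi.single j 1)) * ‖e‖ * ‖x‖ := by ring
      _ ≤ C * iterN A γ N0 n e * ‖x‖ := mul_le_mul_of_nonneg_right (hCn e) (norm_nonneg x)
      _ = _ := by ring

/-- A limit point of the normalized norms satisfies the Barabanov identity. -/
lemma maxA_eq_of_tendsto_iterNnorm (hm : 2 ≤ m) (hr : 1 ≤ r) (hA : IsIrreducibleFamily A)
    (hγ : IsAveraging γ) (hN0 : IsNorm N0) (he : e ≠ 0) {F : Filter ℕ} [F.NeBot] {ρ : ℝ}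
    (hinf : Tendsto (fun n => rhoInf A (iterN A γ N0 n)) F (𝓝 ρ))
    (hsup : Tendsto (fun n => rhoSup A (iterN A γ N0 n)) F (𝓝 ρ)) {P : (Fin m → ℝ) → ℝ}
    (hlim : ∀ x, Tendsto (fun n => iterNnorm A γ N0 e n x) F (𝓝 (P x))) (x : Fin m → ℝ) :
    maxA A P x = ρ * P x := by
  have hN := hN0.iterN hm hr hA hγ
  refine le_antisymm (maxA_le hr fun i => ?_) (not_lt.1 fun hlt => ?_)
  · refine le_of_tendsto_of_tendsto' (hlim _) (hsup.mul (hlim x)) fun n => ?_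
    rw [iterNnorm, iterNnorm, ← mul_div_assoc]
    exact div_le_div_of_nonneg_right
      ((le_maxA A _ i x).trans (maxA_le_rhoSup_mul hr A (hN n) x)) ((hN n).1 e)
  · have hev : ∀ᶠ n in F, ∀ i, iterNnorm A γ N0 e n ((A i).mulVec x) <
        rhoInf A (iterN A γ N0 n) * iterNnorm A γ N0 e n x :=
      eventually_all.2 fun i => (hlim _).eventually_lt (hinf.mul (hlim x))
        ((le_maxA A P i x).trans_lt hlt)
    obtain ⟨n, hn⟩ := hev.exists
    obtain ⟨i, hi⟩ := exists_eq_maxA hr A (iterN A γ N0 n) x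
    have h1 := hn i
    rw [iterNnorm, iterNnorm, ← mul_div_assoc, div_lt_div_iff_of_pos_right ((hN n).pos he),
      hi] at h1
    exact absurd h1 (not_lt.2 (rhoInf_mul_le_maxA hr A (hN n) x))

/-- Two-sided bounds with respect to a Barabanov norm persist, up to scaling, along a
relaxation step. -/
lemma exists_relax_bounds (hr : 1 ≤ r) {N P : (Fin m → ℝ) → ℝ} {ρ g l u : ℝ} (hg : 0 < g)
    (hP : ∀ x, maxA A P x = ρ * P x) (hPn : ∀ x, 0 ≤ P x) (hl : 0 ≤ l) (hu : 0 ≤ u)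
    (hlN : ∀ x, l * P x ≤ N x) (huN : ∀ x, N x ≤ u * P x) :
    ∃ t > 0, ∀ x, t * l * P x ≤ relax A g N x ∧ relax A g N x ≤ t * u * P x := by
  refine ⟨max 1 (g⁻¹ * ρ), lt_max_of_lt_left one_pos, fun x => ⟨?_, ?_⟩⟩
  · rw [mul_assoc, max_mul_of_nonneg _ _ (mul_nonneg hl (hPn x)), one_mul]
    refine max_le_max (hlN x) ?_
    rw [mul_assoc]
    refine mul_le_mul_of_nonneg_left ?_ (inv_pos.2 hg).le
    obtain ⟨i, hi⟩ := exists_eq_maxA hr A P x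
    calc ρ * (l * P x) = l * P ((A i).mulVec x) := by rw [hi, hP]; ring
      _ ≤ _ := (hlN _).trans (le_maxA A N i x)
  · rw [mul_assoc, max_mul_of_nonneg _ _ (mul_nonneg hu (hPn x)), one_mul]
    refine max_le_max (huN x) ?_
    rw [mul_assoc]
    refine mul_le_mul_of_nonneg_left (maxA_le hr fun i => (huN _).trans ?_) (inv_pos.2 hg).le
    calc u * P ((A i).mulVec x) ≤ u * maxA A P x :=
          mul_le_mul_of_nonneg_left (le_maxA A P i x) hu
      _ = _ := by rw [hP]; ring

lemma exists_iterN_bounds (hm : 2 ≤ m) (hr : 1 ≤ r) (hA : IsIrreducibleFamily A)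
    (hγ : IsAveraging γ) (hN0 : IsNorm N0) {P : (Fin m → ℝ) → ℝ} {ρ l u : ℝ}
    (hP : ∀ x, maxA A P x = ρ * P x) (hPn : ∀ x, 0 ≤ P x) (hl : 0 ≤ l) (hu : 0 ≤ u)
    {n : ℕ} (hlu : ∃ t > 0, ∀ x, t * l * P x ≤ iterN A γ N0 n x ∧
      iterN A γ N0 n x ≤ t * u * P x) {k : ℕ} (hk : n ≤ k) :
    ∃ t > 0, ∀ x, t * l * P x ≤ iterN A γ N0 k x ∧ iterN A γ N0 k x ≤ t * u * P x := by
  induction k, hk using Nat.le_induction with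
  | base => exact hlu
  | succ k _ ih =>
    obtain ⟨t, ht, hb⟩ := ih
    obtain ⟨s, hs, hsb⟩ := exists_relax_bounds hr
      (relaxParam_pos hm hr hA hγ (hN0.iterN hm hr hA hγ k)) hP hPn
      (mul_nonneg ht.le hl) (mul_nonneg ht.le hu) (fun x => (hb x).1) fun x => (hb x).2
    exact ⟨s * t, mul_pos hs ht, fun x => by
      simpa only [mul_assoc, iterN_succ] using hsb x⟩

/-- A Barabanov norm that is a limit point of the normalized norms is their limit, uniformly
relative to itself. -/
lemma eventually_abs_iterNnorm_sub_le (hm : 2 ≤ m) (hr : 1 ≤ r) (hA : IsIrreducibleFamily A)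
    (hγ : IsAveraging γ) (hN0 : IsNorm N0) (he : e ≠ 0) {F : Filter ℕ} [F.NeBot] {B ρ : ℝ}
    (hB : ∀ n x, iterNnorm A γ N0 e n x ≤ B * ‖x‖) {P : (Fin m → ℝ) → ℝ} (hPn : IsNorm P)
    (hP : ∀ x, maxA A P x = ρ * P x)
    (hlim : ∀ x, Tendsto (fun n => iterNnorm A γ N0 e n x) F (𝓝 (P x))) {δ : ℝ} (hδ : 0 < δ) :
    ∀ᶠ n in atTop, ∀ x, |iterNnorm A γ N0 e n x - P x| ≤ δ * P x := by
  have hN := hN0.iterN hm hr hA hγ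
  have hPe : P e = 1 := by
    refine tendsto_nhds_unique (hlim e) ((tendsto_congr fun n => ?_).2 tendsto_const_nhds)
    exact div_self ((hN n).pos he).ne'
  set ε : ℝ := min (1 / 2) (δ / 4)
  have hε : 0 < ε := lt_min (by norm_num) (by positivity)
  have hε1 : ε ≤ 1 / 2 := min_le_left _ _
  have hε2 : ε ≤ δ / 4 := min_le_right _ _
  obtain ⟨n, hn⟩ := (eventually_abs_sub_le_mul
    (IsSeminorm.iterNnorm hm hr hA hγ hN0) hB hPn hlim hε).exists
  have hstart : ∃ t > 0, ∀ x, t * (1 - ε) * P x ≤ iterN A γ N0 n x ∧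
      iterN A γ N0 n x ≤ t * (1 + ε) * P x := by
    refine ⟨iterN A γ N0 n e, (hN n).pos he, fun x => ?_⟩
    have h1 := abs_le.1 (hn x)
    have h2 : iterN A γ N0 n x = iterN A γ N0 n e * iterNnorm A γ N0 e n x :=
      (mul_div_cancel₀ _ ((hN n).pos he).ne').symm
    rw [h2, mul_assoc, mul_assoc]
    exact ⟨mul_le_mul_of_nonneg_left (by linarith [h1.1]) ((hN n).1 e),
      mul_le_mul_of_nonneg_left (by linarith [h1.2]) ((hN n).1 e)⟩
  filter_upwards [eventually_ge_atTop n] with k hk x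
  obtain ⟨t, ht, hb⟩ := exists_iterN_bounds hm hr hA hγ hN0 hP hPn.1
    (by linarith) (by linarith) hstart hk
  obtain ⟨hx1, hx2⟩ := hb x
  obtain ⟨he1, he2⟩ := hb e
  rw [hPe, mul_one] at he1 he2
  have hPx := hPn.1 x
  have hepos := (hN k).pos he
  have key1 : (1 - δ) * (1 + ε) ≤ 1 - ε := by nlinarith
  have key2 : 1 + ε ≤ (1 + δ) * (1 - ε) := by nlinarith
  rw [abs_le, iterNnorm]
  constructor
  · suffices h : (1 - δ) * P x ≤ iterN A γ N0 k x / iterN A γ N0 k e by linarith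
    rw [le_div_iff₀ hepos]
    rcases le_total (1 - δ) 0 with hneg | hpos
    · exact (mul_nonpos_of_nonpos_of_nonneg (mul_nonpos_of_nonpos_of_nonneg hneg hPx)
        hepos.le).trans ((hN k).1 x)
    calc (1 - δ) * P x * iterN A γ N0 k e ≤ (1 - δ) * P x * (t * (1 + ε)) :=
          mul_le_mul_of_nonneg_left he2 (mul_nonneg hpos hPx)
      _ = t * ((1 - δ) * (1 + ε)) * P x := by ring
      _ ≤ t * (1 - ε) * P x := by gcongr
      _ ≤ _ := hx1
  · suffices h : iterN A γ N0 k x / iterN A γ N0 k e ≤ (1 + δ) * P x by linarith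
    rw [div_le_iff₀ hepos]
    calc iterN A γ N0 k x ≤ t * (1 + ε) * P x := hx2
      _ ≤ t * ((1 + δ) * (1 - ε)) * P x := by gcongr
      _ = (1 + δ) * P x * (t * (1 - ε)) := by ring
      _ ≤ _ := mul_le_mul_of_nonneg_left he1 (by positivity)

end limit

/-- the normalized norms `‖·‖°_n` of the max-relaxation iteration converge,
uniformly on every bounded subset of `ℝ^m`, to some Barabanov norm of `𝒜`. -/
theorem stmt2 {m r : ℕ} (hm : 2 ≤ m) (hr : 1 ≤ r)
    (A : Fin r → Matrix (Fin m) (Fin m) ℝ) (hA : IsIrreducibleFamily A)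
    (γ : ℝ → ℝ → ℝ) (hγ : IsAveraging γ)
    (N0 : (Fin m → ℝ) → ℝ) (hN0 : IsNorm N0)
    (e : Fin m → ℝ) (he : N0 e = 1) :
    ∃ Nstar : (Fin m → ℝ) → ℝ, IsNorm Nstar ∧
      (∀ x, jsr A * Nstar x = maxA A Nstar x) ∧
      ∀ S : Set (Fin m → ℝ), IsBounded S →
        TendstoUniformlyOn (fun n => iterNnorm A γ N0 e n) Nstar atTop S := by
  have he0 : e ≠ 0 := by
    rintro rfl
    simp [hN0.isSeminorm.map_zero] at he
  obtain ⟨ρ, hρ, hinf, hsup⟩ := exists_tendsto_rhoInf_rhoSup hm hr hA hγ hN0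
  obtain ⟨c, hc, B, hcB⟩ := exists_iterNnorm_bounds hm hr hA hγ hN0 he0
  let U : Ultrafilter ℕ := Ultrafilter.of atTop
  have hU : (U : Filter ℕ) ≤ atTop := Ultrafilter.of_le atTop
  obtain ⟨P, hPs, hlim⟩ := exists_seminorm_ultrafilter_limit U
    (IsSeminorm.iterNnorm hm hr hA hγ hN0) fun n x => (hcB n x).2
  have hPc : ∀ x, c * ‖x‖ ≤ P x := fun x => ge_of_tendsto' (hlim x) fun n => (hcB n x).1
  have hPn : IsNorm P := ⟨hPs.1, fun x hx => norm_le_zero_iff.1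
    (nonpos_of_mul_nonpos_right ((hPc x).trans_eq hx) hc), hPs.2⟩
  have hPA := maxA_eq_of_tendsto_iterNnorm hm hr hA hγ hN0 he0 (hinf.mono_left hU)
    (hsup.mono_left hU) hlim
  refine ⟨P, hPn, fun x => ?_, fun S hS => ?_⟩
  · rw [jsr_eq_of_maxA_eq hm hr hPn hρ.le hPA, hPA]
  · obtain ⟨R, hR⟩ := hS.exists_norm_le
    set D := ∑ j, P (Pi.single j 1)
    have hD : 0 ≤ D := hPs.basisSum_nonneg
    refine Metric.tendstoUniformlyOn_iff.2 fun ε hε => ?_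
    have hK : 0 < D * |R| + 1 := by positivity
    filter_upwards [eventually_abs_iterNnorm_sub_le hm hr hA hγ hN0 he0
      (fun n x => (hcB n x).2) hPn hPA hlim (div_pos hε hK)] with n hn x hx
    rw [dist_comm, Real.dist_eq]
    have hPx : P x < D * |R| + 1 := ((hPs.le_sum_mul_norm x).trans
      (mul_le_mul_of_nonneg_left ((hR x hx).trans (le_abs_self R)) hD)).trans_lt (lt_add_one _)
    calc _ ≤ ε / (D * |R| + 1) * P x := hn x
      _ < ε / (D * |R| + 1) * (D * |R| + 1) := mul_lt_mul_of_pos_left hPx (div_pos hε hK)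
      _ = ε := div_mul_cancel₀ _ hK.ne'
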